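/- Assume γ, K, z, B, W > 0 with 0 < W ≤ B and γ·(K/2)·z² ≥ 1, and let P > 0. Define R₂(q) = 4·[K·z + (√q + δ)²]·[ (2·(W/B)/√((κ/8)·q))·(√π/2)·erf(√(q/(3·K·z))) + (25·(W/B)/(γ·K·z²))·exp(−q/(√18·K·z)) + 5·exp(−√(γ·K·z²) − √(γ/(20·K))·q) ] for q > 0, and set c₂ = (100/(γ·K·z²))·[K·z + δ² + √(6·K·z/e)·δ + √18·K·z/e] and c₃ = 20·[K·z + δ² + (80·K/(γ·e²))^{1/4}·δ + √(20·K/(γ·e²))]·exp(−√(γ·K·z²)). Then: (i) R₂(q) ≤ (W/B)·c₂ + c₃ + (16·(W/B)/(γ·K·z²))·f(1/(3·K·z), q + P_o) for all q > 0; (ii) the map P ↦ (W/B)·c₂ + c₃ + (16·(W/B)/(γ·K·z²))·f(1/(3·K·z), P + P_o) is nondecreasing and concave on (0, ∞); and (iii) for every random variable Π with Π > 0 almost surely and E[Π] ≤ P, E[R₂(Π)] ≤ (W/B)·c₂ + c₃ + (16·(W/B)/(γ·K·z²))·f(1/(3·K·z), P + P_o). -/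

import Mathlib

open MeasureTheory

/-- The error function `erf(y) = (2/√π)·∫₀^y e^{−u²} du`. -/
noncomputable def erf (y : ℝ) : ℝ := (2 / Real.sqrt Real.pi) * ∫ u in (0:ℝ)..y, Real.exp (-u ^ 2)

/-- `δ = √(3Kz/(4e))`. -/
noncomputable def dlt (K z : ℝ) : ℝ := Real.sqrt (3 * K * z / (4 * Real.exp 1))

/-- `f(s,P) = [K·z + (√P + δ)²]·(√π/2)·erf(√(s·P))/√(s·P)`. -/
noncomputable def ffun (K z s P : ℝ) : ℝ :=
  (K * z + (Real.sqrt P + dlt K z) ^ 2) * (Real.sqrt Real.pi / 2) *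
    erf (Real.sqrt (s * P)) / Real.sqrt (s * P)

section

open Real Set

theorem sqrt_pi_div_two_mul_erf (x : ℝ) :
    √π / 2 * erf x = ∫ u in (0 : ℝ)..x, exp (-u ^ 2) := by
  have : √π ≠ 0 := by positivity
  unfold erf
  field_simp

theorem hasDerivAt_integral_exp_neg_sq (x : ℝ) :
    HasDerivAt (fun y => ∫ u in (0 : ℝ)..y, exp (-u ^ 2)) (exp (-x ^ 2)) x := by
  have hc : Continuous fun u : ℝ => exp (-u ^ 2) := by fun_prop
  exact intervalIntegral.integral_hasDerivAt_right (hc.intervalIntegrable _ _)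
    (hc.stronglyMeasurableAtFilter _ _) hc.continuousAt

theorem integral_exp_neg_sq_nonneg {x : ℝ} (hx : 0 ≤ x) :
    0 ≤ ∫ u in (0 : ℝ)..x, exp (-u ^ 2) :=
  intervalIntegral.integral_nonneg hx fun _ _ => (exp_pos _).le

theorem integral_exp_neg_sq_le {x : ℝ} (hx : 0 ≤ x) :
    ∫ u in (0 : ℝ)..x, exp (-u ^ 2) ≤ x := by
  have hc : Continuous fun u : ℝ => exp (-u ^ 2) := by fun_prop
  calc ∫ u in (0 : ℝ)..x, exp (-u ^ 2) ≤ ∫ _ in (0 : ℝ)..x, (1 : ℝ) :=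
        intervalIntegral.integral_mono_on hx (hc.intervalIntegrable _ _) (by simp)
          fun u _ => exp_le_one_iff.2 (by nlinarith [sq_nonneg u])
    _ = x := by simp

/-- The profile `(√x + 2d + A/√x)·∫₀^{c√x} e^{-u²} du`, a multiple of `ffun` in its last argument. -/
noncomputable def powerProfile (A d c x : ℝ) : ℝ :=
  (√x + 2 * d + A / √x) * ∫ u in (0 : ℝ)..(c * √x), exp (-u ^ 2)

/-- The derivative of `powerProfile` on the positive reals. -/
noncomputable def powerProfileDeriv (A d c x : ℝ) : ℝ :=
  (1 / (2 * √x) - A / (2 * (x * √x))) * (∫ u in (0 : ℝ)..(c * √x), exp (-u ^ 2)) +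
    (√x + 2 * d + A / √x) * (c * exp (-(c ^ 2 * x)) / (2 * √x))

theorem ffun_eq_powerProfile {K z s x : ℝ} (hs : 0 < s) (hx : 0 < x) :
    ffun K z s x = powerProfile (K * z + dlt K z ^ 2) (dlt K z) (√s) x / √s := by
  have h : (K * z + (√x + dlt K z) ^ 2) * (√π / 2) * erf (√s * √x) =
      (K * z + (√x + dlt K z) ^ 2) * ∫ u in (0 : ℝ)..(√s * √x), exp (-u ^ 2) := by
    rw [← sqrt_pi_div_two_mul_erf]; ring
  have hx' : 0 < √x := sqrt_pos.2 hx
  have hs' : 0 < √s := sqrt_pos.2 hs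
  rw [ffun, sqrt_mul hs.le, h, powerProfile]
  field_simp
  ring

theorem hasDerivAt_sqrt_add_const_add_div_sqrt (A d : ℝ) {x : ℝ} (hx : 0 < x) :
    HasDerivAt (fun y => √y + 2 * d + A / √y) (1 / (2 * √x) - A / (2 * (x * √x))) x := by
  have hx' : 0 < √x := sqrt_pos.2 hx
  have h := hasDerivAt_sqrt hx.ne'
  refine ((h.add_const (2 * d)).fun_add
    ((hasDerivAt_const x A).fun_div h hx'.ne')).congr_deriv ?_
  rw [sq_sqrt hx.le]
  field_simp
  ring

theorem hasDerivAt_integral_exp_neg_sq_sqrt (c : ℝ) {x : ℝ} (hx : 0 < x) :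
    HasDerivAt (fun y => ∫ u in (0 : ℝ)..(c * √y), exp (-u ^ 2))
      (c * exp (-(c ^ 2 * x)) / (2 * √x)) x := by
  have h := (hasDerivAt_integral_exp_neg_sq (c * √x)).comp x
    ((hasDerivAt_sqrt hx.ne').const_mul c)
  refine h.congr_deriv ?_
  rw [mul_pow, sq_sqrt hx.le]
  ring

theorem hasDerivAt_powerProfile (A d c : ℝ) {x : ℝ} (hx : 0 < x) :
    HasDerivAt (powerProfile A d c) (powerProfileDeriv A d c x) x :=
  (hasDerivAt_sqrt_add_const_add_div_sqrt A d hx).mul (hasDerivAt_integral_exp_neg_sq_sqrt c hx)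

theorem powerProfileDeriv_nonneg {A d c x : ℝ} (hA : 0 < A) (hd : 0 ≤ d) (hc : 0 < c)
    (hcA : c ^ 2 * A ≤ 1) (hx : 0 < x) : 0 ≤ powerProfileDeriv A d c x := by
  have hr : 0 < √x := sqrt_pos.2 hx
  have hr2 : √x ^ 2 = x := sq_sqrt hx.le
  set G := ∫ u in (0 : ℝ)..(c * √x), exp (-u ^ 2) with hG
  have hG0 : 0 ≤ G := integral_exp_neg_sq_nonneg (by positivity)
  have hG1 : G ≤ c * √x := integral_exp_neg_sq_le (by positivity)
  have he : 1 - c ^ 2 * x ≤ exp (-(c ^ 2 * x)) := by linarith [add_one_le_exp (-(c ^ 2 * x))]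
  have heq : powerProfileDeriv A d c x =
      ((x - A) * G + (x + 2 * d * √x + A) * (c * √x * exp (-(c ^ 2 * x)))) / (2 * (x * √x)) := by
    rw [powerProfileDeriv, ← hG]
    field_simp
    linear_combination -(c * exp (-(x * c ^ 2)) * (2 * √x * d + A)) * hr2
  rw [heq]
  refine div_nonneg ?_ (by positivity)
  have hcr : 0 < c * √x := by positivity
  rcases le_total A x with h | h
  · have : 0 ≤ x - A := sub_nonneg.2 h
    positivity
  · have h1 : (A - x) * G ≤ (A - x) * (c * √x) :=
      mul_le_mul_of_nonneg_left hG1 (sub_nonneg.2 h)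
    have h2 : A - x ≤ (x + A) * (1 - c ^ 2 * x) := by
      have : c ^ 2 * x ≤ c ^ 2 * A := by gcongr
      nlinarith
    have h3 : (x + A) * (1 - c ^ 2 * x) ≤ (x + 2 * d * √x + A) * exp (-(c ^ 2 * x)) := by
      have h4 : (x + A) * (1 - c ^ 2 * x) ≤ (x + A) * exp (-(c ^ 2 * x)) := by gcongr
      have h5 : 0 ≤ 2 * d * √x * exp (-(c ^ 2 * x)) := by positivity
      linarith
    have h6 := mul_le_mul_of_nonneg_right (h2.trans h3) hcr.le
    linarith

theorem monotoneOn_powerProfile {A d c : ℝ} (hA : 0 < A) (hd : 0 ≤ d) (hc : 0 < c)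
    (hcA : c ^ 2 * A ≤ 1) : MonotoneOn (powerProfile A d c) (Ioi 0) := by
  refine monotoneOn_of_hasDerivWithinAt_nonneg (f' := powerProfileDeriv A d c) (convex_Ioi 0)
    (fun x hx => (hasDerivAt_powerProfile A d c hx).continuousAt.continuousWithinAt) ?_ ?_ <;>
    rw [interior_Ioi]
  · exact fun x hx => (hasDerivAt_powerProfile A d c hx).hasDerivWithinAt
  · exact fun x hx => powerProfileDeriv_nonneg hA hd hc hcA hx

theorem hasDerivAt_powerProfileDeriv (A d c : ℝ) {x : ℝ} (hx : 0 < x) :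
    HasDerivAt (powerProfileDeriv A d c)
      ((-(1 / (4 * (x * √x))) + 3 * A / (4 * (x ^ 2 * √x))) *
          (∫ u in (0 : ℝ)..(c * √x), exp (-u ^ 2)) +
        c * exp (-(c ^ 2 * x)) / (2 * √x) *
          (2 * (1 / (2 * √x) - A / (2 * (x * √x))) -
            (√x + 2 * d + A / √x) * (c ^ 2 + 1 / (2 * x)))) x := by
  have hr : 0 < √x := sqrt_pos.2 hx
  have hr2 : √x ^ 2 = x := sq_sqrt hx.le
  have h := hasDerivAt_sqrt hx.ne'
  have h2 := h.const_mul 2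
  have hu : HasDerivAt (fun y => 1 / (2 * √y) - A / (2 * (y * √y)))
      (-(1 / (4 * (x * √x))) + 3 * A / (4 * (x ^ 2 * √x))) x := by
    refine (((hasDerivAt_const x 1).fun_div h2 (by positivity)).sub
      ((hasDerivAt_const x A).fun_div (((hasDerivAt_id' x).fun_mul h).const_mul 2)
        (by positivity))).congr_deriv ?_
    field_simp
    rw [hr2]
    field_simp
    ring
  have hv : HasDerivAt (fun y => c * exp (-(c ^ 2 * y)) / (2 * √y))
      (-(c * exp (-(c ^ 2 * x)) / (2 * √x) * (c ^ 2 + 1 / (2 * x)))) x := by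
    refine (((((hasDerivAt_id' x).const_mul (c ^ 2)).fun_neg.exp).const_mul c).fun_div h2
      (by positivity)).congr_deriv ?_
    field_simp
    rw [hr2]
    field_simp
    ring
  refine ((hu.fun_mul (hasDerivAt_integral_exp_neg_sq_sqrt c hx)).fun_add
    ((hasDerivAt_sqrt_add_const_add_div_sqrt A d hx).fun_mul hv)).congr_deriv ?_
  ring

theorem concaveOn_powerProfile {A d c : ℝ} (hA : 0 < A) (hd : 0 ≤ d) (hc : 0 < c)
    (hcA : 1 ≤ c ^ 2 * (3 * A)) : ConcaveOn ℝ (Ioi (3 * A)) (powerProfile A d c) := by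
  have hpos : ∀ x ∈ Ioi (3 * A), 0 < x := fun x hx => lt_trans (by positivity) hx
  refine concaveOn_of_hasDerivWithinAt2_nonpos (f' := powerProfileDeriv A d c) (convex_Ioi _)
    (fun x hx => (hasDerivAt_powerProfile A d c (hpos x hx)).continuousAt.continuousWithinAt)
    ?_ (fun x hx => (hasDerivAt_powerProfileDeriv A d c (x := x) ?_).hasDerivWithinAt) ?_
  · rw [interior_Ioi]
    exact fun x hx => (hasDerivAt_powerProfile A d c (hpos x hx)).hasDerivWithinAt
  · rw [interior_Ioi] at hx
    exact hpos x hx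
  rw [interior_Ioi]
  intro x hx
  have hx0 := hpos x hx
  have hr : 0 < √x := sqrt_pos.2 hx0
  have hr2 : √x ^ 2 = x := sq_sqrt hx0.le
  have hcx : 1 ≤ c ^ 2 * x := hcA.trans (by gcongr; exact (mem_Ioi.1 hx).le)
  have hG := integral_exp_neg_sq_nonneg (x := c * √x) (by positivity)
  have h1 : -(1 / (4 * (x * √x))) + 3 * A / (4 * (x ^ 2 * √x)) ≤ 0 := by
    have : -(1 / (4 * (x * √x))) + 3 * A / (4 * (x ^ 2 * √x)) =
        -((x - 3 * A) / (4 * (x ^ 2 * √x))) := by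
      field_simp
      ring
    rw [this, neg_nonpos]
    exact div_nonneg (sub_nonneg.2 (mem_Ioi.1 hx).le) (by positivity)
  have h2 : 2 * (1 / (2 * √x) - A / (2 * (x * √x))) -
      (√x + 2 * d + A / √x) * (c ^ 2 + 1 / (2 * x)) ≤ 0 := by
    have h3 : 2 * (1 / (2 * √x) - A / (2 * (x * √x))) ≤ 1 / √x := by
      have : 0 ≤ A / (x * √x) := by positivity
      have h4 : 2 * (1 / (2 * √x) - A / (2 * (x * √x))) = 1 / √x - A / (x * √x) := by
        field_simp
      linarith
    have h5 : 1 / √x ≤ √x * c ^ 2 := by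
      rw [div_le_iff₀ hr]
      nlinarith
    have h6 : √x * c ^ 2 ≤ (√x + 2 * d + A / √x) * (c ^ 2 + 1 / (2 * x)) := by
      have h7 : 0 ≤ 2 * d + A / √x := by positivity
      have h8 : 0 ≤ 1 / (2 * x) := by positivity
      gcongr <;> linarith
    linarith
  exact add_nonpos (mul_nonpos_of_nonpos_of_nonneg h1 hG)
    (mul_nonpos_of_nonneg_of_nonpos (by positivity) h2)

theorem ConcaveOn.le_add_mul_of_hasDerivAt {S : Set ℝ} {f : ℝ → ℝ} {m x y : ℝ}
    (hf : ConcaveOn ℝ S f) (hx : x ∈ S) (hy : y ∈ S) (hm : HasDerivAt f m x) :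
    f y ≤ f x + m * (y - x) := by
  rcases lt_trichotomy x y with h | rfl | h
  · have := hf.slope_le_of_hasDerivAt hx hy h hm
    rw [slope_def_field, div_le_iff₀ (sub_pos.2 h)] at this
    linarith
  · simp
  · have := hf.le_slope_of_hasDerivAt hy hx h hm
    rw [slope_def_field, le_div_iff₀ (sub_pos.2 h)] at this
    linarith

theorem mul_exp_neg_div_le (x : ℝ) {b : ℝ} (hb : 0 < b) :
    x * exp (-(x / b)) ≤ b / exp 1 := by
  have h := mul_le_mul_of_nonneg_left (mul_exp_neg_le_exp_neg_one (x / b)) hb.le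
  rw [exp_neg 1, ← mul_assoc, mul_div_cancel₀ _ hb.ne'] at h
  exact h

theorem sqrt_mul_exp_neg_div_le {x b : ℝ} (hx : 0 ≤ x) (hb : 0 < b) :
    √x * exp (-(x / b)) ≤ √(b / (2 * exp 1)) := by
  apply le_sqrt_of_sq_le
  have h := mul_exp_neg_div_le x (half_pos hb)
  have h1 : exp (-(x / b)) ^ 2 = exp (-(x / (b / 2))) := by
    rw [← exp_nat_mul]
    congr 1
    push_cast
    field_simp
  rw [mul_pow, sq_sqrt hx, h1]
  exact h.trans_eq (by field_simp)

theorem add_sq_mul_exp_neg_div_le {a d x : ℝ} (ha : 0 < a) (hd : 0 ≤ d)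
    (hda : d ^ 2 = 3 * a / (4 * exp 1)) (hx : 0 ≤ x) :
    (a + (√x + d) ^ 2) * exp (-(x / (√18 * a))) ≤
      a + d ^ 2 + √(6 * a / exp 1) * d + √18 * a / exp 1 := by
  have he := exp_pos 1
  have he3 : exp 1 < 3 := exp_one_lt_d9.trans (by norm_num)
  have hm0 : 0 < √2 := by positivity
  have hm2 : √2 ^ 2 = (2 : ℝ) := sq_sqrt (by norm_num)
  have hm1 : (1 : ℝ) < √2 := by nlinarith
  have h18 : √18 = 3 * √2 := by
    rw [sqrt_eq_iff_mul_self_eq (by norm_num) (by positivity)]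
    linear_combination -9 * hm2
  have h6 : √(6 * a / exp 1) = 2 * √2 * d := by
    rw [sqrt_eq_iff_mul_self_eq (by positivity) (by positivity)]
    have : 6 * a / exp 1 = 8 * d ^ 2 := by rw [hda]; field_simp; norm_num
    rw [this]
    linear_combination -4 * d ^ 2 * hm2
  have had : a = 4 * exp 1 * d ^ 2 / 3 := by rw [hda]; field_simp
  have hb : 0 < √18 * a := by positivity
  have hlast := mul_exp_neg_div_le x hb
  set t := x / (√18 * a) with ht
  have ht0 : 0 ≤ t := by positivity
  have hxt : x = 4 * √2 * exp 1 * d ^ 2 * t := by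
    rw [ht, h18, had]
    have : d ^ 2 ≠ 0 := by rw [hda]; positivity
    have : d ≠ 0 := fun h => this (by simp [h])
    field_simp
  have hr2 : √x ^ 2 = x := sq_sqrt hx
  have hamgm : 2 * √x * d ≤ 2 * √2 * d ^ 2 + 2 * exp 1 * d ^ 2 * t := by
    have h1 : 0 ≤ (√x - 2 * √2 * d) ^ 2 := sq_nonneg _
    have h2 : 2 * √2 * (2 * √x * d) ≤
        2 * √2 * (2 * √2 * d ^ 2 + 2 * exp 1 * d ^ 2 * t) := by linarith
    exact le_of_mul_le_mul_left h2 (by positivity)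
  have hlin : a + d ^ 2 + 2 * √x * d ≤ (a + d ^ 2 + 2 * √2 * d ^ 2) * exp t := by
    have h1 : (a + d ^ 2 + 2 * √2 * d ^ 2) * (t + 1) ≤
        (a + d ^ 2 + 2 * √2 * d ^ 2) * exp t := by
      gcongr
      exact add_one_le_exp t
    have h2 : 2 * exp 1 * d ^ 2 ≤ a + d ^ 2 + 2 * √2 * d ^ 2 := by
      rw [had]
      nlinarith [sq_nonneg d]
    have h3 := mul_le_mul_of_nonneg_right h2 ht0
    linarith
  have hexp : exp t * exp (-t) = 1 := by rw [← exp_add]; simp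
  have hfirst := mul_le_mul_of_nonneg_right hlin (exp_pos (-t)).le
  rw [mul_assoc _ (exp t), hexp] at hfirst
  rw [h6]
  calc (a + (√x + d) ^ 2) * exp (-t)
      = (a + d ^ 2 + 2 * √x * d) * exp (-t) + x * exp (-t) := by
        linear_combination exp (-t) * hr2
    _ ≤ _ := by linarith

theorem add_sq_mul_exp_neg_sqrt_mul_le {a d γ K x : ℝ} (ha : 0 < a) (hd : 0 ≤ d) (hγ : 0 < γ)
    (hK : 0 < K) (hx : 0 ≤ x) :
    (a + (√x + d) ^ 2) * exp (-(√(γ / (20 * K)) * x)) ≤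
      a + d ^ 2 + (80 * K / (γ * exp 1 ^ 2)) ^ ((1 : ℝ) / 4) * d +
        √(20 * K / (γ * exp 1 ^ 2)) := by
  have he := exp_pos 1
  set b := √(20 * K / γ) with hb
  have hb0 : 0 < b := by positivity
  have hb2 : b ^ 2 = 20 * K / γ := sq_sqrt (by positivity)
  have hinv : √(γ / (20 * K)) * x = x / b := by
    rw [hb, ← inv_div (20 * K) γ, sqrt_inv, div_eq_inv_mul x]
  have h20 : √(20 * K / (γ * exp 1 ^ 2)) = b / exp 1 := by
    rw [← div_div, sqrt_div' _ (by positivity), sqrt_sq he.le]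
  have h80 : (80 * K / (γ * exp 1 ^ 2)) ^ ((1 : ℝ) / 4) = 2 * √(b / (2 * exp 1)) := by
    have h1 : 80 * K / (γ * exp 1 ^ 2) = (2 * √(b / (2 * exp 1))) ^ 4 := by
      have h2 : √(b / (2 * exp 1)) ^ 2 = b / (2 * exp 1) := sq_sqrt (by positivity)
      have h3 : (2 * √(b / (2 * exp 1))) ^ 4 = 16 * (√(b / (2 * exp 1)) ^ 2) ^ 2 := by ring
      rw [h3, h2, div_pow, hb2]
      field_simp
      norm_num
    rw [h1, ← rpow_natCast, ← rpow_mul (by positivity)]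
    norm_num
  rw [hinv, h20, h80]
  have h1 := mul_exp_neg_div_le x hb0
  have h2 := mul_le_mul_of_nonneg_right (sqrt_mul_exp_neg_div_le hx hb0)
    (by positivity : 0 ≤ 2 * d)
  have h3 : (a + d ^ 2) * exp (-(x / b)) ≤ a + d ^ 2 :=
    mul_le_of_le_one_right (by positivity) (exp_le_one_iff.2 (by simp; positivity))
  have hr2 : √x ^ 2 = x := sq_sqrt hx
  calc (a + (√x + d) ^ 2) * exp (-(x / b))
      = (a + d ^ 2) * exp (-(x / b)) + √x * exp (-(x / b)) * (2 * d) + x * exp (-(x / b)) := by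
        linear_combination exp (-(x / b)) * hr2
    _ ≤ _ := by linarith

end

theorem average_power_bound_high
    {Ω : Type*} [MeasureSpace Ω] [IsProbabilityMeasure (volume : Measure Ω)]
    (γ K z B W P : ℝ)
    (hγ : 0 < γ) (hK : 0 < K) (hz : 0 < z) (hB : 0 < B) (hW : 0 < W) (hP : 0 < P)
    (hWB : W ≤ B) (hhigh : 1 ≤ γ * (K / 2) * z ^ 2)
    (κ δ Po c₂ c₃ : ℝ)
    (hκ : κ = 2 * γ ^ 2 * K * z ^ 3 / 3)
    (hδ : δ = Real.sqrt (3 * K * z / (4 * Real.exp 1)))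
    (hPo : Po = 3 * (K * z + δ ^ 2))
    (hc₂ : c₂ = (100 / (γ * K * z ^ 2)) * (K * z + δ ^ 2 +
      Real.sqrt (6 * K * z / Real.exp 1) * δ + Real.sqrt 18 * K * z / Real.exp 1))
    (hc₃ : c₃ = 20 * (K * z + δ ^ 2 + (80 * K / (γ * Real.exp 1 ^ 2)) ^ ((1:ℝ)/4) * δ +
      Real.sqrt (20 * K / (γ * Real.exp 1 ^ 2))) * Real.exp (-Real.sqrt (γ * K * z ^ 2)))
    (R₂ : ℝ → ℝ)
    (hR₂ : ∀ q, 0 < q → R₂ q =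
      4 * (K * z + (Real.sqrt q + δ) ^ 2) *
        ((2 * (W / B) / Real.sqrt ((κ / 8) * q)) * (Real.sqrt Real.pi / 2) *
            erf (Real.sqrt (q / (3 * K * z))) +
          (25 * (W / B) / (γ * K * z ^ 2)) * Real.exp (-(q / (Real.sqrt 18 * K * z))) +
          5 * Real.exp (-Real.sqrt (γ * K * z ^ 2) - Real.sqrt (γ / (20 * K)) * q)))
    (Prand : Ω → ℝ) (hPrand_pos : ∀ᵐ ω : Ω, 0 < Prand ω) (hPrand_int : Integrable Prand)
    (hPrand_mean : ∫ ω, Prand ω ≤ P) :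
    (∀ q, 0 < q → R₂ q ≤ (W / B) * c₂ + c₃ +
      (16 * (W / B) / (γ * K * z ^ 2)) * ffun K z (1 / (3 * K * z)) (q + Po)) ∧
    (MonotoneOn (fun P' => (W / B) * c₂ + c₃ +
        (16 * (W / B) / (γ * K * z ^ 2)) * ffun K z (1 / (3 * K * z)) (P' + Po))
        (Set.Ioi (0:ℝ)) ∧
      ConcaveOn ℝ (Set.Ioi (0:ℝ)) (fun P' => (W / B) * c₂ + c₃ +
        (16 * (W / B) / (γ * K * z ^ 2)) * ffun K z (1 / (3 * K * z)) (P' + Po))) ∧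
    (∫ ω, R₂ (Prand ω)) ≤ (W / B) * c₂ + c₃ +
      (16 * (W / B) / (γ * K * z ^ 2)) * ffun K z (1 / (3 * K * z)) (P + Po) := by
  have he := Real.exp_pos 1
  have hδ0 : 0 ≤ δ := hδ ▸ Real.sqrt_nonneg _
  have hδ2 : δ ^ 2 = 3 * (K * z) / (4 * Real.exp 1) := by
    rw [hδ, Real.sq_sqrt (by positivity), mul_assoc]
  have hδdlt : dlt K z = δ := hδ.symm
  have hKz : 0 < K * z := by positivity
  set A := K * z + δ ^ 2 with hA
  have hA0 : 0 < A := by positivity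
  have hPo0 : 0 < Po := by rw [hPo]; positivity
  set s := 1 / (3 * K * z) with hs
  have hs0 : 0 < s := by positivity
  have hc0 : 0 < √s := Real.sqrt_pos.2 hs0
  have hc2 : √s ^ 2 = s := Real.sq_sqrt hs0.le
  have hcA : √s ^ 2 * A ≤ 1 := by
    have h : √s ^ 2 * A = (1 + 3 / (4 * Real.exp 1)) / 3 := by
      rw [hc2, hs, hA, hδ2]
      field_simp
    have h1 : 3 / (4 * Real.exp 1) ≤ 1 := by
      rw [div_le_one (by positivity)]
      linarith [Real.add_one_le_exp 1]
    rw [h]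
    linarith
  have hcA' : 1 ≤ √s ^ 2 * (3 * A) := by
    have h : √s ^ 2 * (3 * A) = 1 + 3 / (4 * Real.exp 1) := by
      rw [hc2, hs, hA, hδ2]
      field_simp
    rw [h]
    linarith [show 0 ≤ 3 / (4 * Real.exp 1) by positivity]
  have hf : ∀ x, 0 < x → ffun K z s x = powerProfile A δ (√s) x / √s := fun x hx => by
    rw [ffun_eq_powerProfile hs0 hx, hδdlt]
  have hmono := monotoneOn_powerProfile hA0 hδ0 hc0 hcA
  have hconc := concaveOn_powerProfile hA0 hδ0 hc0 hcA'
  rw [← hPo] at hconc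
  set C := 16 * (W / B) / (γ * K * z ^ 2) with hC
  have hC0 : 0 ≤ C := by positivity
  have hCs : 0 ≤ C / √s := by positivity
  have hF : ∀ x, 0 < x → (W / B) * c₂ + c₃ + C * ffun K z s (x + Po) =
      (W / B) * c₂ + c₃ + C / √s * powerProfile A δ (√s) (x + Po) := fun x hx => by
    rw [hf _ (by positivity)]
    ring
  have hbound : ∀ q, 0 < q → R₂ q ≤ (W / B) * c₂ + c₃ + C * ffun K z s (q + Po) := by
    intro q hq
    have hle : ffun K z s q ≤ ffun K z s (q + Po) := by
      rw [hf q hq, hf _ (by positivity)]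
      gcongr
      exact hmono hq (Set.mem_Ioi.2 (by positivity)) (by linarith)
    have hmain : 4 * (K * z + (√q + δ) ^ 2) * (2 * (W / B) / √(κ / 8 * q) * (√Real.pi / 2) *
        erf √(q / (3 * K * z))) = C * ffun K z s q := by
      have hsq : s * q = q / (3 * K * z) := by rw [hs]; ring
      have hκq : √(κ / 8 * q) = γ * K * z ^ 2 / 2 * √(q / (3 * K * z)) := by
        rw [Real.sqrt_eq_iff_mul_self_eq (by rw [hκ]; positivity) (by positivity)]
        have h := Real.mul_self_sqrt (show 0 ≤ q / (3 * K * z) by positivity)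
        rw [mul_mul_mul_comm, h, hκ]
        field_simp
        norm_num
      have hpos : 0 < √(q / (3 * K * z)) := by positivity
      rw [ffun, hδdlt, hsq, hκq, hC]
      field_simp
      ring
    have h2 := add_sq_mul_exp_neg_div_le hKz hδ0 hδ2 hq.le
    have h3 := add_sq_mul_exp_neg_sqrt_mul_le hKz hδ0 hγ hK hq.le
    simp only [← mul_assoc] at h2 h3
    have h2' := mul_le_mul_of_nonneg_left h2
      (show 0 ≤ W / B * (100 / (γ * K * z ^ 2)) by positivity)
    have h3' := mul_le_mul_of_nonneg_left h3
      (show 0 ≤ 20 * Real.exp (-√(γ * K * z ^ 2)) by positivity)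
    have hexp : Real.exp (-√(γ * K * z ^ 2) - √(γ / (20 * K)) * q) =
        Real.exp (-√(γ * K * z ^ 2)) * Real.exp (-(√(γ / (20 * K)) * q)) := by
      rw [← Real.exp_add, sub_eq_add_neg]
    rw [hR₂ q hq, hexp, hc₂, hc₃]
    have hCle := mul_le_mul_of_nonneg_left hle hC0
    rw [← hmain] at hCle
    linear_combination hCle + h2' + h3'
  have hshift : ConcaveOn ℝ (Set.Ioi (0 : ℝ)) fun x => powerProfile A δ (√s) (x + Po) := by
    have h := hconc.translate_left Po
    rwa [Set.preimage_const_add_Ioi, sub_self] at h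
  refine ⟨hbound, ⟨?_, ?_⟩, ?_⟩
  · intro x hx y hy hxy
    have hx' : 0 < x := hx
    have hy' : 0 < y := hy
    have h : powerProfile A δ (√s) (x + Po) ≤ powerProfile A δ (√s) (y + Po) :=
      hmono (Set.mem_Ioi.2 (by positivity)) (Set.mem_Ioi.2 (by positivity)) (by linarith)
    simp only [hF x hx', hF y hy']
    gcongr
  · refine ((concaveOn_const ((W / B) * c₂ + c₃) hshift.1).add (hshift.smul hCs)).congr fun x hx => ?_
    simp only [hF x hx, smul_eq_mul, Pi.add_apply]
  · set D := C / √s * powerProfileDeriv A δ (√s) (P + Po) with hD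
    have hD0 : 0 ≤ D :=
      mul_nonneg hCs (powerProfileDeriv_nonneg hA0 hδ0 hc0 hcA (by positivity))
    set F := (W / B) * c₂ + c₃ + C * ffun K z s (P + Po) with hFP
    have hline : ∀ q, 0 < q → R₂ q ≤ F + D * (q - P) := fun q hq => by
      refine (hbound q hq).trans ?_
      have h := hconc.le_add_mul_of_hasDerivAt (Set.mem_Ioi.2 (by linarith : Po < P + Po))
        (Set.mem_Ioi.2 (by linarith : Po < q + Po))
        (hasDerivAt_powerProfile A δ (√s) (by positivity))
      have h' := mul_le_mul_of_nonneg_left h hCs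
      rw [hFP, hF q hq, hF P hP, hD]
      linear_combination h'
    have hnonneg : ∀ q, 0 < q → 0 ≤ R₂ q := fun q hq => by
      have h : 0 ≤ √Real.pi / 2 * erf √(q / (3 * K * z)) := by
        rw [sqrt_pi_div_two_mul_erf]
        exact integral_exp_neg_sq_nonneg (Real.sqrt_nonneg _)
      rw [hR₂ q hq, mul_assoc (2 * (W / B) / _)]
      positivity
    have hint : Integrable fun ω => Prand ω - P := hPrand_int.sub (integrable_const P)
    calc ∫ ω, R₂ (Prand ω) ≤ ∫ ω, (F + D * (Prand ω - P)) :=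
          integral_mono_of_nonneg (hPrand_pos.mono fun ω hω => hnonneg _ hω)
            ((integrable_const F).add (hint.const_mul D))
            (hPrand_pos.mono fun ω hω => hline _ hω)
      _ = F + D * ((∫ ω, Prand ω) - P) := by
          rw [integral_add (integrable_const F) (hint.const_mul D), integral_const_mul,
            integral_sub hPrand_int (integrable_const P)]
          simp
      _ ≤ F := by
          have h := mul_nonneg hD0 (sub_nonneg.2 hPrand_mean)
          linarith
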